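/- Let u : [0,1] → ℝ be integrable, nonnegative, and non-increasing. Then for every q ∈ (0,1], ∫_0^q u(t) dt + q·∫_q^1 (u(t)/t) dt ≤ (1 − ln q)·∫_0^q u(t) dt. -/

import Mathlib

open Real Set intervalIntegral

theorem stmt_1 (u : ℝ → ℝ)
    (hint : IntervalIntegrable u MeasureTheory.volume 0 1)
    (hnonneg : ∀ t ∈ Set.Icc (0:ℝ) 1, 0 ≤ u t)
    (hanti : AntitoneOn u (Set.Icc (0:ℝ) 1)) :
    ∀ q ∈ Set.Ioc (0:ℝ) 1,
      (∫ t in (0:ℝ)..q, u t) + q * (∫ t in q..1, u t / t)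
        ≤ (1 - Real.log q) * ∫ t in (0:ℝ)..q, u t := by
  intro q hq
  obtain ⟨hq0, hq1⟩ := hq
  have hqm : q ∈ Set.Icc (0:ℝ) 1 := ⟨hq0.le, hq1⟩
  have hi1 : IntervalIntegrable u MeasureTheory.volume 0 q := by
    apply hint.mono_set
    rw [Set.uIcc_of_le hq0.le, Set.uIcc_of_le zero_le_one]
    exact Set.Icc_subset_Icc le_rfl hq1
  have hi2 : IntervalIntegrable u MeasureTheory.volume q 1 := by
    apply hint.mono_set
    rw [Set.uIcc_of_le hq1, Set.uIcc_of_le zero_le_one]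
    exact Set.Icc_subset_Icc hq0.le le_rfl
  have hc : ContinuousOn (fun t : ℝ => t⁻¹) (Set.uIcc q 1) := by
    rw [Set.uIcc_of_le hq1]
    apply continuousOn_inv₀.mono
    intro t ht
    exact (lt_of_lt_of_le hq0 ht.1).ne'
  have hi3 : IntervalIntegrable (fun t => u t / t) MeasureTheory.volume q 1 := by
    simpa [div_eq_mul_inv] using hi2.mul_continuousOn hc
  have hA : q * u q ≤ ∫ t in (0:ℝ)..q, u t := by
    have h := intervalIntegral.integral_mono_on (f := fun _ => u q) (g := u) hq0.le
      intervalIntegrable_const hi1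
      (fun t ht => hanti ⟨ht.1, ht.2.trans hq1⟩ hqm ht.2)
    simpa using h
  have hB : (∫ t in q..1, u t / t) ≤ u q * (-Real.log q) := by
    have h := intervalIntegral.integral_mono_on (f := fun t => u t / t)
      (g := fun t => u q * t⁻¹) hq1 hi3 (hc.intervalIntegrable.const_mul _)
      (fun t ht => by
        rw [div_eq_mul_inv]
        have h0 : 0 ≤ t := hq0.le.trans ht.1
        exact mul_le_mul_of_nonneg_right (hanti hqm ⟨h0, ht.2⟩ ht.1) (inv_nonneg.2 h0))
    rw [intervalIntegral.integral_const_mul, integral_inv_of_pos hq0 one_pos,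
      one_div, Real.log_inv] at h
    exact h
  have hl : 0 ≤ -Real.log q := by
    have := Real.log_nonpos hq0.le hq1
    linarith
  have h1 := mul_le_mul_of_nonneg_left hB hq0.le
  have h2 := mul_le_mul_of_nonneg_right hA hl
  nlinarith
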